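/- arXiv:1811.00261 — 5 statements merged into one kernel-verified Lean document; each statement's English description precedes it below -/
import Mathlib

section
/- Let 0 → R → F →π→ L → 0 and 0 → R′ → F′ →π′→ L → 0 be two free presentations of the same Lie algebra L over a field 𝔽. Then there is an isomorphism of Lie algebras (hence of 𝔽-vector spaces, the quotients being abelian) (F² ∩ R)/⁅R,F⁆ ≅ (F′² ∩ R′)/⁅R′,F′⁆. In other words, the Schur multiplier M(L) = (F² ∩ R)/⁅R,F⁆ is independent of the choice of free presentation. -/
/-- The canonical quotient map `L → L ⧸ I` by a Lie ideal, as a Lie algebra homomorphism. -/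
def lieQuotMk {R L : Type*} [CommRing R] [LieRing L] [LieAlgebra R L]
    (I : LieIdeal R L) : L →ₗ⁅R⁆ L ⧸ I :=
  { I.toSubmodule.mkQ with map_lie' := rfl }

/-- Given a surjection `π : F → L` from a free Lie algebra (a free presentation of `L`
with `R = ker π`), the Schur multiplier `(F² ∩ R)/⁅R,F⁆` of `L`, realized as the image
of the ideal `F² ∩ R` in the quotient `F/⁅R,F⁆`. -/
noncomputable def schurMultiplier {𝔽 X L : Type*} [Field 𝔽] [LieRing L] [LieAlgebra 𝔽 L]
    (π : FreeLieAlgebra 𝔽 X →ₗ⁅𝔽⁆ L) :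
    LieIdeal 𝔽 (FreeLieAlgebra 𝔽 X ⧸ ⁅π.ker, (⊤ : LieIdeal 𝔽 (FreeLieAlgebra 𝔽 X))⁆) :=
  LieIdeal.map (lieQuotMk ⁅π.ker, (⊤ : LieIdeal 𝔽 (FreeLieAlgebra 𝔽 X))⁆)
    (⁅(⊤ : LieIdeal 𝔽 (FreeLieAlgebra 𝔽 X)), ⊤⁆ ⊓ π.ker)

/-- A Lie algebra homomorphism `f : L → L'` with `I ≤ f⁻¹(J)` descends to `L ⧸ I → L' ⧸ J`. -/
def lieQuotMap {R L L' : Type*} [CommRing R] [LieRing L] [LieAlgebra R L]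
    [LieRing L'] [LieAlgebra R L'] {I : LieIdeal R L} {J : LieIdeal R L'}
    (f : L →ₗ⁅R⁆ L') (h : I ≤ J.comap f) : L ⧸ I →ₗ⁅R⁆ L' ⧸ J :=
  { Submodule.mapQ I.toSubmodule J.toSubmodule (f : L →ₗ[R] L') h with
    map_lie' := by
      intro x y
      induction x using Submodule.Quotient.induction_on
      induction y using Submodule.Quotient.induction_on
      exact congrArg (lieQuotMk J) (f.map_lie _ _) }

theorem lieQuotMk_surjective {R L : Type*} [CommRing R] [LieRing L] [LieAlgebra R L]
    (I : LieIdeal R L) : Function.Surjective (lieQuotMk I) :=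
  Submodule.mkQ_surjective _

theorem lieQuotMk_eq_iff {R L : Type*} [CommRing R] [LieRing L] [LieAlgebra R L]
    {I : LieIdeal R L} {x y : L} : lieQuotMk I x = lieQuotMk I y ↔ x - y ∈ I :=
  Submodule.Quotient.eq I.toSubmodule

/-- A homomorphism over `L` maps `⁅ker π, ⊤⁆` into `⁅ker π', ⊤⁆`. -/
theorem lie_ker_top_le_comap {R F F' L : Type*} [CommRing R] [LieRing F] [LieAlgebra R F]
    [LieRing F'] [LieAlgebra R F'] [LieRing L] [LieAlgebra R L]
    {π : F →ₗ⁅R⁆ L} {π' : F' →ₗ⁅R⁆ L} (f : F →ₗ⁅R⁆ F') (hf : ∀ x, π' (f x) = π x) :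
    ⁅π.ker, (⊤ : LieIdeal R F)⁆ ≤ LieIdeal.comap f ⁅π'.ker, (⊤ : LieIdeal R F')⁆ := by
  refine (LieSubmodule.lie_le_iff _ _ _).2 fun a ha b _ => ?_
  rw [LieIdeal.mem_comap, f.map_lie]
  refine LieSubmodule.lie_mem_lie ?_ (LieSubmodule.mem_top _)
  rw [LieHom.mem_ker] at ha ⊢
  rw [hf, ha]

/-- An endomorphism over `L` is the identity on `⁅⊤, ⊤⁆` modulo `⁅ker π, ⊤⁆`. -/
theorem map_sub_self_mem_lie_ker_top {R F L : Type*} [CommRing R] [LieRing F] [LieAlgebra R F]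
    [LieRing L] [LieAlgebra R L] {π : F →ₗ⁅R⁆ L} (e : F →ₗ⁅R⁆ F) (he : ∀ x, π (e x) = π x)
    {x : F} (hx : x ∈ ⁅(⊤ : LieIdeal R F), (⊤ : LieIdeal R F)⁆) :
    e x - x ∈ ⁅π.ker, (⊤ : LieIdeal R F)⁆ := by
  have hker : ∀ a, e a - a ∈ π.ker := fun a => by
    rw [LieHom.mem_ker, map_sub, he, sub_self]
  rw [← LieSubmodule.mem_toSubmodule, LieSubmodule.lieIdeal_oper_eq_linear_span'] at hx
  induction hx using Submodule.span_induction with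
  | mem x hx =>
    obtain ⟨a, -, b, -, rfl⟩ := hx
    have h : e ⁅a, b⁆ - ⁅a, b⁆ = ⁅e a - a, e b⁆ - ⁅e b - b, a⁆ := by
      rw [e.map_lie, sub_lie, sub_lie, ← lie_skew (e b) a, ← lie_skew b a]
      abel
    rw [h]
    exact sub_mem (LieSubmodule.lie_mem_lie (hker a) (LieSubmodule.mem_top _))
      (LieSubmodule.lie_mem_lie (hker b) (LieSubmodule.mem_top _))
  | zero => simp
  | add x y _ _ hx hy =>
    rw [map_add, add_sub_add_comm]
    exact add_mem hx hy
  | smul c x _ hx =>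
    rw [map_smul, ← smul_sub]
    exact SMulMemClass.smul_mem c hx

/-- A homomorphism from a free Lie algebra lifts along any surjection. -/
theorem FreeLieAlgebra.exists_lift_of_surjective {R X F L : Type*} [CommRing R]
    [LieRing F] [LieAlgebra R F] [LieRing L] [LieAlgebra R L]
    (π : FreeLieAlgebra R X →ₗ⁅R⁆ L) {p : F →ₗ⁅R⁆ L} (hp : Function.Surjective p) :
    ∃ f : FreeLieAlgebra R X →ₗ⁅R⁆ F, ∀ x, p (f x) = π x := by
  choose s hs using hp
  refine ⟨FreeLieAlgebra.lift R fun x => s (π (FreeLieAlgebra.of R x)), fun x => ?_⟩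
  rw [← LieHom.comp_apply]
  congr 1
  ext y
  simp [hs]

theorem mem_schurMultiplier {𝔽 X L : Type*} [Field 𝔽] [LieRing L] [LieAlgebra 𝔽 L]
    {π : FreeLieAlgebra 𝔽 X →ₗ⁅𝔽⁆ L}
    {y : FreeLieAlgebra 𝔽 X ⧸ ⁅π.ker, (⊤ : LieIdeal 𝔽 (FreeLieAlgebra 𝔽 X))⁆} :
    y ∈ schurMultiplier π ↔
      ∃ x, x ∈ ⁅(⊤ : LieIdeal 𝔽 (FreeLieAlgebra 𝔽 X)), (⊤ : LieIdeal 𝔽 (FreeLieAlgebra 𝔽 X))⁆ ∧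
        π x = 0 ∧ lieQuotMk ⁅π.ker, (⊤ : LieIdeal 𝔽 (FreeLieAlgebra 𝔽 X))⁆ x = y := by
  constructor
  · intro hy
    obtain ⟨⟨x, hx⟩, rfl⟩ := LieIdeal.mem_map_of_surjective (lieQuotMk_surjective _) hy
    rw [LieSubmodule.mem_inf, LieHom.mem_ker] at hx
    exact ⟨x, hx.1, hx.2, rfl⟩
  · rintro ⟨x, hx, hπx, rfl⟩
    exact LieIdeal.mem_map ((LieSubmodule.mem_inf _ _ _).2 ⟨hx, LieHom.mem_ker.2 hπx⟩)

theorem lieQuotMap_mem_schurMultiplier {𝔽 X X' L : Type*} [Field 𝔽] [LieRing L] [LieAlgebra 𝔽 L]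
    {π : FreeLieAlgebra 𝔽 X →ₗ⁅𝔽⁆ L} {π' : FreeLieAlgebra 𝔽 X' →ₗ⁅𝔽⁆ L}
    (f : FreeLieAlgebra 𝔽 X →ₗ⁅𝔽⁆ FreeLieAlgebra 𝔽 X') (hf : ∀ x, π' (f x) = π x)
    {y} (hy : y ∈ schurMultiplier π) :
    lieQuotMap f (lie_ker_top_le_comap f hf) y ∈ schurMultiplier π' := by
  obtain ⟨x, hx, hπx, rfl⟩ := mem_schurMultiplier.1 hy
  refine mem_schurMultiplier.2 ⟨f x, ?_, by rw [hf, hπx], rfl⟩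
  exact LieSubmodule.mono_lie le_top le_top
    (LieIdeal.map_bracket_le f (LieIdeal.mem_map hx))

theorem lieQuotMap_lieQuotMap_of_mem_schurMultiplier {𝔽 X X' L : Type*} [Field 𝔽] [LieRing L]
    [LieAlgebra 𝔽 L] {π : FreeLieAlgebra 𝔽 X →ₗ⁅𝔽⁆ L} {π' : FreeLieAlgebra 𝔽 X' →ₗ⁅𝔽⁆ L}
    (f : FreeLieAlgebra 𝔽 X →ₗ⁅𝔽⁆ FreeLieAlgebra 𝔽 X') (hf : ∀ x, π' (f x) = π x)
    (g : FreeLieAlgebra 𝔽 X' →ₗ⁅𝔽⁆ FreeLieAlgebra 𝔽 X) (hg : ∀ x, π (g x) = π' x)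
    {y} (hy : y ∈ schurMultiplier π) :
    lieQuotMap g (lie_ker_top_le_comap g hg) (lieQuotMap f (lie_ker_top_le_comap f hf) y) = y := by
  obtain ⟨x, hx, -, rfl⟩ := mem_schurMultiplier.1 hy
  exact lieQuotMk_eq_iff.2
    (map_sub_self_mem_lie_ker_top (g.comp f) (fun x => by simp [hf, hg]) hx)

/-- Proposition 2.3; purely even case.
Let `0 → R → F →π→ L → 0` and `0 → R' → F' →π'→ L → 0` be two free presentations of the
same Lie algebra `L` over a field `𝔽`.  Then there is an isomorphism of Lie algebras
(hence of `𝔽`-vector spaces, the quotients being abelian)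
`(F² ∩ R)/⁅R,F⁆ ≅ (F'² ∩ R')/⁅R',F'⁆`; i.e. the Schur multiplier
`M(L) = (F² ∩ R)/⁅R,F⁆` is independent of the choice of free presentation. -/
theorem schurMultiplier_independent_of_presentation
    {𝔽 X X' L : Type*} [Field 𝔽] [LieRing L] [LieAlgebra 𝔽 L]
    (π : FreeLieAlgebra 𝔽 X →ₗ⁅𝔽⁆ L) (hπ : Function.Surjective π)
    (π' : FreeLieAlgebra 𝔽 X' →ₗ⁅𝔽⁆ L) (hπ' : Function.Surjective π') :
    Nonempty ((schurMultiplier π) ≃ₗ⁅𝔽⁆ (schurMultiplier π')) := by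
  obtain ⟨f, hf⟩ := FreeLieAlgebra.exists_lift_of_surjective π hπ'
  obtain ⟨g, hg⟩ := FreeLieAlgebra.exists_lift_of_surjective π' hπ
  exact ⟨
    { toFun := fun y => ⟨_, lieQuotMap_mem_schurMultiplier f hf y.2⟩
      invFun := fun y => ⟨_, lieQuotMap_mem_schurMultiplier g hg y.2⟩
      map_add' := fun _ _ => Subtype.ext (map_add _ _ _)
      map_smul' := fun _ _ => Subtype.ext (map_smul _ _ _)
      map_lie' := Subtype.ext (LieHom.map_lie _ _ _)
      left_inv := fun y =>
        Subtype.ext (lieQuotMap_lieQuotMap_of_mem_schurMultiplier f hf g hg y.2)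
      right_inv := fun y =>
        Subtype.ext (lieQuotMap_lieQuotMap_of_mem_schurMultiplier g hg f hf y.2) }⟩
end

section
/- (5-sequence of cohomology) Let L be a Lie algebra over a field 𝔽 and H a central ideal of L, with quotient map π : L → L/H. Then the sequence 0 → Hom(L/H, 𝔽) →Inf→ Hom(L, 𝔽) →Res→ Hom(H, 𝔽) →Tra→ H²(L/H, 𝔽) →Inf→ H²(L, 𝔽) is exact, where Inf(f) = f ∘ π, Res(g) = g restricted to H, Tra(α) is the cohomology class of α ∘ f for f a factor set of the central extension 0 → H → L → L/H → 0, and the second Inf sends the class of β to the class of (x,y) ↦ β(π(x), π(y)). -/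
theorem lieQuotMk_eq_zero_iff {R L : Type*} [CommRing R] [LieRing L] [LieAlgebra R L]
    (I : LieIdeal R L) (x : L) : lieQuotMk I x = 0 ↔ x ∈ I :=
  Submodule.Quotient.mk_eq_zero I.toSubmodule

/-- The projection `x ↦ x - μ (π x)` of `L` onto the ideal `I` along a linear section `μ` of the
quotient map `π`. -/
def lieQuotProj {R L : Type*} [CommRing R] [LieRing L] [LieAlgebra R L] (I : LieIdeal R L)
    (μ : (L ⧸ I) →ₗ[R] L) (hsec : ∀ q : L ⧸ I, lieQuotMk I (μ q) = q) : L →ₗ[R] I :=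
  LinearMap.codRestrict I.toSubmodule (LinearMap.id - μ ∘ₗ (lieQuotMk I : L →ₗ[R] L ⧸ I))
    fun x => (lieQuotMk_eq_zero_iff I _).1 <| by simp [hsec]

section

variable {R L : Type*} [CommRing R] [LieRing L] [LieAlgebra R L] (I : LieIdeal R L)
  (μ : (L ⧸ I) →ₗ[R] L) (hsec : ∀ q : L ⧸ I, lieQuotMk I (μ q) = q)

theorem coe_lieQuotProj (x : L) :
    (lieQuotProj I μ hsec x : L) = x - μ (lieQuotMk I x) := rfl

theorem lieQuotProj_coe (h : I) : lieQuotProj I μ hsec h = h := by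
  ext
  rw [coe_lieQuotProj, (lieQuotMk_eq_zero_iff I _).2 h.2, map_zero, sub_zero]

theorem lie_section_lieQuotMk (hcent : ∀ h ∈ I, ∀ x : L, ⁅h, x⁆ = 0)
    (hsec : ∀ q : L ⧸ I, lieQuotMk I (μ q) = q) (x y : L) :
    ⁅μ (lieQuotMk I x), μ (lieQuotMk I y)⁆ = ⁅x, y⁆ := by
  have hx := hcent _ (lieQuotProj I μ hsec x).2 (μ (lieQuotMk I y))
  have hy := hcent _ (lieQuotProj I μ hsec y).2 x
  rw [coe_lieQuotProj, sub_lie, sub_eq_zero] at hx hy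
  rw [← hx, ← lie_skew, ← hy, lie_skew]

theorem lieQuotProj_lie (hcent : ∀ h ∈ I, ∀ x : L, ⁅h, x⁆ = 0)
    (hmem : ∀ q r : L ⧸ I, ⁅μ q, μ r⁆ - μ ⁅q, r⁆ ∈ I) (x y : L) :
    lieQuotProj I μ hsec ⁅x, y⁆ =
      ⟨⁅μ (lieQuotMk I x), μ (lieQuotMk I y)⁆ - μ ⁅lieQuotMk I x, lieQuotMk I y⁆,
        hmem _ _⟩ := by
  ext
  simp only [coe_lieQuotProj, lie_section_lieQuotMk I μ hcent hsec, LieHom.map_lie]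

end

/-- Theorem 3.1, the 5-sequence of cohomology; purely even case.
Let `L` be a Lie algebra over a field `𝔽` and `H` a central ideal of `L`, with quotient
map `π = lieQuotMk H : L → L/H`, a linear section `μ` of `π` and associated factor set
`f(q,r) = ⁅μ q, μ r⁆ − μ ⁅q,r⁆ ∈ H`.  Then the sequence
`0 → Hom(L/H,𝔽) →Inf→ Hom(L,𝔽) →Res→ Hom(H,𝔽) →Tra→ H²(L/H,𝔽) →Inf→ H²(L,𝔽)`
is exact.  Here `Hom(A,𝔽)` is the space of linear maps vanishing on `⁅A,A⁆` (all linear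
maps on the central `H`), `Inf(f) = f ∘ π`, `Res(g) = g|_H`, `Tra(α) = [α ∘ f]`, and
the second `Inf` sends `[β]` to `[(x,y) ↦ β(π x, π y)]`.  Exactness is expressed
pointwise: (1) `Inf` is injective; (2) `Inf g ∈ ker Res ↔ g ∈ Im Inf`;
(3) `Tra α = 0` (i.e. `α∘f ∈ B²(L/H,𝔽)`) iff `α ∈ Im Res`;
(4) for a cocycle `g ∈ Z²(L/H,𝔽)`, `Inf [g] = 0` (i.e. `g∘(π×π) ∈ B²(L,𝔽)`) iff
`[g] ∈ Im Tra` (i.e. `α∘f − g ∈ B²(L/H,𝔽)` for some `α`). -/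
theorem five_sequence_exact
    {𝔽 L : Type*} [Field 𝔽] [LieRing L] [LieAlgebra 𝔽 L]
    (H : LieIdeal 𝔽 L)
    (hcent : ∀ h ∈ H, ∀ x : L, ⁅h, x⁆ = 0)
    (μ : (L ⧸ H) →ₗ[𝔽] L)
    (hsec : ∀ q : L ⧸ H, lieQuotMk H (μ q) = q)
    (hmem : ∀ q r : L ⧸ H, ⁅μ q, μ r⁆ - μ ⁅q, r⁆ ∈ H) :
    -- exactness at Hom(L/H, 𝔽): Inf is injective
    (∀ f : (L ⧸ H) →ₗ[𝔽] 𝔽, (∀ q r : L ⧸ H, f ⁅q, r⁆ = 0) →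
      (∀ x : L, f (lieQuotMk H x) = 0) → f = 0) ∧
    -- exactness at Hom(L, 𝔽): Im(Inf) = ker(Res)
    (∀ g : L →ₗ[𝔽] 𝔽, (∀ x y : L, g ⁅x, y⁆ = 0) →
      ((∀ h ∈ H, g h = 0) ↔
        ∃ f : (L ⧸ H) →ₗ[𝔽] 𝔽, (∀ q r : L ⧸ H, f ⁅q, r⁆ = 0) ∧
          ∀ x : L, g x = f (lieQuotMk H x))) ∧
    -- exactness at Hom(H, 𝔽): ker(Tra) = Im(Res)
    (∀ α : H →ₗ[𝔽] 𝔽,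
      ((∃ σ : (L ⧸ H) →ₗ[𝔽] 𝔽, ∀ q r : L ⧸ H,
          α ⟨⁅μ q, μ r⁆ - μ ⁅q, r⁆, hmem q r⟩ = -σ ⁅q, r⁆) ↔
        ∃ g : L →ₗ[𝔽] 𝔽, (∀ x y : L, g ⁅x, y⁆ = 0) ∧ ∀ h : H, g h = α h)) ∧
    -- exactness at H²(L/H, 𝔽): ker(Inf) = Im(Tra)
    (∀ g : (L ⧸ H) →ₗ[𝔽] (L ⧸ H) →ₗ[𝔽] 𝔽,
      (∀ q : L ⧸ H, g q q = 0) →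
      (∀ q r s : L ⧸ H, g ⁅q, r⁆ s + g ⁅r, s⁆ q + g ⁅s, q⁆ r = 0) →
      ((∃ θ : L →ₗ[𝔽] 𝔽, ∀ x y : L,
          g (lieQuotMk H x) (lieQuotMk H y) = -θ ⁅x, y⁆) ↔
        ∃ (α : H →ₗ[𝔽] 𝔽) (σ : (L ⧸ H) →ₗ[𝔽] 𝔽), ∀ q r : L ⧸ H,
          α ⟨⁅μ q, μ r⁆ - μ ⁅q, r⁆, hmem q r⟩ - g q r = -σ ⁅q, r⁆)) := by
  refine ⟨fun f _ hf => ?_, fun g hg => ⟨fun hgH => ?_, ?_⟩, fun α => ⟨?_, ?_⟩,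
    fun g _ _ => ⟨?_, ?_⟩⟩
  · ext q
    simpa [hsec] using hf (μ q)
  · have hμ : ∀ x : L, g x = g (μ (lieQuotMk H x)) := fun x => by
      have := hgH _ (lieQuotProj H μ hsec x).2
      rwa [coe_lieQuotProj, map_sub, sub_eq_zero] at this
    refine ⟨g ∘ₗ μ, fun q r => ?_, hμ⟩
    have := hμ ⁅μ q, μ r⁆
    rw [hg, LieHom.map_lie, hsec, hsec] at this
    exact this.symm
  · rintro ⟨f, -, hf⟩ h hh
    rw [hf, (lieQuotMk_eq_zero_iff H h).2 hh, map_zero]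
  · rintro ⟨σ, hσ⟩
    refine ⟨α ∘ₗ lieQuotProj H μ hsec + σ ∘ₗ (lieQuotMk H : L →ₗ[𝔽] L ⧸ H),
      fun x y => ?_, fun h => ?_⟩
    · simp [lieQuotProj_lie H μ hsec hcent hmem, hσ]
    · simp [lieQuotProj_coe, (lieQuotMk_eq_zero_iff H _).2 h.2]
  · rintro ⟨g, hg, hgα⟩
    refine ⟨g ∘ₗ μ, fun q r => ?_⟩
    simp [← hgα, hg]
  · rintro ⟨θ, hθ⟩
    refine ⟨-(θ ∘ₗ H.toSubmodule.subtype), -(θ ∘ₗ μ), fun q r => ?_⟩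
    have := hθ (μ q) (μ r)
    rw [hsec, hsec] at this
    have hsub : H.toSubmodule.subtype ⟨⁅μ q, μ r⁆ - μ ⁅q, r⁆, hmem q r⟩ =
      ⁅μ q, μ r⁆ - μ ⁅q, r⁆ := rfl
    simp [this, hsub]
  · rintro ⟨α, σ, h⟩
    refine ⟨-(α ∘ₗ lieQuotProj H μ hsec) - σ ∘ₗ (lieQuotMk H : L →ₗ[𝔽] L ⧸ H),
      fun x y => ?_⟩
    have := h (lieQuotMk H x) (lieQuotMk H y)
    rw [← lieQuotProj_lie H μ hsec hcent hmem] at this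
    simp only [LinearMap.sub_apply, LinearMap.neg_apply, LinearMap.comp_apply,
      LieHom.coe_toLinearMap, LieHom.map_lie]
    linear_combination -this
end

section
/- Let L be a finite-dimensional Lie algebra over a field 𝔽 and Z a central ideal of L. Then ⁅L,L⁆ ∩ Z is isomorphic as an 𝔽-vector space to the image of the transgression map Tra : Hom(Z, 𝔽) → H²(L/Z, 𝔽). -/
set_option maxSynthPendingDepth 3

variable (𝔽 A : Type*) [Field 𝔽] [LieRing A] [LieAlgebra 𝔽 A]

/-- `Z²(A,𝔽)`: the alternating bilinear 2-cocycles on `A` with values in the trivial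
module `𝔽`, i.e. bilinear `g` with `g x x = 0` and
`g ⁅x,y⁆ z + g ⁅y,z⁆ x + g ⁅z,x⁆ y = 0`. -/
def lieZ2 : Submodule 𝔽 (A →ₗ[𝔽] A →ₗ[𝔽] 𝔽) where
  carrier := {g | (∀ x : A, g x x = 0) ∧
    ∀ x y z : A, g ⁅x, y⁆ z + g ⁅y, z⁆ x + g ⁅z, x⁆ y = 0}
  add_mem' := by
    rintro a b ⟨ha1, ha2⟩ ⟨hb1, hb2⟩
    refine ⟨fun x => ?_, fun x y z => ?_⟩
    · simp [ha1 x, hb1 x]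
    · have h1 := ha2 x y z
      have h2 := hb2 x y z
      simp only [LinearMap.add_apply]
      linear_combination h1 + h2
  zero_mem' := by
    refine ⟨fun x => ?_, fun x y z => ?_⟩ <;> simp
  smul_mem' := by
    rintro c a ⟨ha1, ha2⟩
    refine ⟨fun x => ?_, fun x y z => ?_⟩
    · simp [ha1 x]
    · have h := ha2 x y z
      simp only [LinearMap.smul_apply, smul_eq_mul]
      linear_combination c * h

/-- `B²(A,𝔽)`: the 2-coboundaries `(x,y) ↦ -σ ⁅x,y⁆` (for linear `σ : A → 𝔽`), as a
subspace of `Z²(A,𝔽)`. -/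
def lieB2 : Submodule 𝔽 (lieZ2 𝔽 A) where
  carrier := {g | ∃ σ : A →ₗ[𝔽] 𝔽,
    ∀ x y : A, (g : A →ₗ[𝔽] A →ₗ[𝔽] 𝔽) x y = -σ ⁅x, y⁆}
  add_mem' := by
    rintro a b ⟨σa, ha⟩ ⟨σb, hb⟩
    exact ⟨σa + σb, fun x y => by
      simp [Submodule.coe_add, LinearMap.add_apply, ha x y, hb x y]; ring⟩
  zero_mem' := ⟨0, fun x y => by simp⟩
  smul_mem' := by
    rintro c a ⟨σ, ha⟩
    exact ⟨c • σ, fun x y => by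
      simp [Submodule.coe_smul, LinearMap.smul_apply, ha x y]⟩

/-- `H²(A,𝔽) = Z²(A,𝔽)/B²(A,𝔽)`: the second cohomology group of `A` with coefficients
in the trivial module `𝔽`. -/
abbrev lieH2 := (↥(lieZ2 𝔽 A)) ⧸ lieB2 𝔽 A

/-- A linear functional on a subspace `p` that vanishes on `p ⊓ q` extends to a functional on the
whole space that vanishes on `q`. -/
theorem Submodule.exists_dual_extension_vanishing {K V : Type*} [Field K] [AddCommGroup V]
    [Module K V] (p q : Submodule K V) (α : p →ₗ[K] K) (h : ∀ z : p, (z : V) ∈ q → α z = 0) :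
    ∃ β : V →ₗ[K] K, (∀ z : p, β z = α z) ∧ ∀ x ∈ q, β x = 0 := by
  have hα : α ∈ LinearMap.range (q.mkQ ∘ₗ p.subtype).dualMap := by
    rw [LinearMap.range_dualMap_eq_dualAnnihilator_ker, Submodule.mem_dualAnnihilator]
    intro z hz
    exact h z (by simpa using hz)
  obtain ⟨γ, rfl⟩ := hα
  refine ⟨γ ∘ₗ q.mkQ, fun z => rfl, fun x hx => ?_⟩
  rw [LinearMap.comp_apply, Submodule.mkQ_apply, (Submodule.Quotient.mk_eq_zero q).mpr hx, map_zero]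

/-- If `Z` is central, `L → L ⧸ Z` has linear section `μ`, and `c` is the bilinear form `α ∘ f` for
the factor set `f` of `μ`, then `c` is of the form `-σ ⁅q, r⁆` if and only if `α` vanishes on
`⁅L, L⁆ ⊓ Z`. -/
theorem factorSet_coboundary_iff {𝔽 L : Type*} [Field 𝔽] [LieRing L] [LieAlgebra 𝔽 L]
    (Z : LieIdeal 𝔽 L)
    (hcent : ∀ z ∈ Z, ∀ x : L, ⁅z, x⁆ = 0)
    (μ : (L ⧸ Z) →ₗ[𝔽] L)
    (hsec : ∀ q : L ⧸ Z, lieQuotMk Z (μ q) = q)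
    (hmem : ∀ q r : L ⧸ Z, ⁅μ q, μ r⁆ - μ ⁅q, r⁆ ∈ Z)
    (α : Z →ₗ[𝔽] 𝔽) :
    (∃ σ : (L ⧸ Z) →ₗ[𝔽] 𝔽, ∀ q r : L ⧸ Z,
      α ⟨⁅μ q, μ r⁆ - μ ⁅q, r⁆, hmem q r⟩ = -σ ⁅q, r⁆) ↔
    ∀ z : Z, (z : L) ∈ ⁅(⊤ : LieIdeal 𝔽 L), (⊤ : LieIdeal 𝔽 L)⁆ → α z = 0 := by
  have hker : ∀ x : L, lieQuotMk Z x = 0 ↔ x ∈ Z := fun x =>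
    Submodule.Quotient.mk_eq_zero Z.toSubmodule
  constructor
  · rintro ⟨σ, hσ⟩ z hz
    have hdiff : ∀ x : L, x - μ (lieQuotMk Z x) ∈ Z := fun x => by
      rw [← hker, map_sub, hsec, sub_self]
    let ρ : L →ₗ[𝔽] Z := LinearMap.codRestrict Z.toSubmodule
      (LinearMap.id - μ ∘ₗ (lieQuotMk Z : L →ₗ[𝔽] L ⧸ Z)) hdiff
    let β : L →ₗ[𝔽] 𝔽 := α ∘ₗ ρ + σ ∘ₗ (lieQuotMk Z : L →ₗ[𝔽] L ⧸ Z)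
    have hbracket : ∀ x y : L, ⁅x, y⁆ = ⁅μ (lieQuotMk Z x), μ (lieQuotMk Z y)⁆ := fun x y => by
      have h1 := hcent _ (hdiff x) y
      have h2 := hcent _ (hdiff y) (μ (lieQuotMk Z x))
      rw [sub_lie, sub_eq_zero] at h1
      rw [← lie_skew, neg_eq_zero, lie_sub, sub_eq_zero] at h2
      rw [h1, h2]
    have hβ : ∀ x y : L, β ⁅x, y⁆ = 0 := fun x y => by
      have hρ : ρ ⁅x, y⁆ = ⟨_, hmem (lieQuotMk Z x) (lieQuotMk Z y)⟩ := Subtype.ext <| by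
        change ⁅x, y⁆ - μ (lieQuotMk Z ⁅x, y⁆) = _
        rw [LieHom.map_lie, hbracket]
      change α (ρ ⁅x, y⁆) + σ (lieQuotMk Z ⁅x, y⁆) = 0
      rw [hρ, hσ, LieHom.map_lie, neg_add_cancel]
    have hβz : β z = 0 := by
      rw [← LieSubmodule.mem_toSubmodule, LieSubmodule.lieIdeal_oper_eq_linear_span'] at hz
      refine (Submodule.span_le.mpr ?_ : _ ≤ LinearMap.ker β) hz
      rintro _ ⟨x, -, y, -, rfl⟩
      exact hβ x y
    have hz0 : lieQuotMk Z (z : L) = 0 := (hker z).mpr z.2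
    have hρz : ρ z = z := Subtype.ext <| by
      change (z : L) - μ (lieQuotMk Z (z : L)) = z
      rw [hz0, map_zero, sub_zero]
    change α (ρ z) + σ (lieQuotMk Z (z : L)) = 0 at hβz
    rwa [hρz, hz0, map_zero, add_zero] at hβz
  · intro h
    obtain ⟨β, hβα, hβ⟩ := Submodule.exists_dual_extension_vanishing Z.toSubmodule
      ⁅(⊤ : LieIdeal 𝔽 L), (⊤ : LieIdeal 𝔽 L)⁆.toSubmodule α h
    refine ⟨β ∘ₗ μ, fun q r => ?_⟩
    rw [← hβα ⟨_, hmem q r⟩]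
    change β (⁅μ q, μ r⁆ - μ ⁅q, r⁆) = -β (μ ⁅q, r⁆)
    rw [map_sub, hβ _ (LieSubmodule.lie_mem_lie (LieSubmodule.mem_top _) (LieSubmodule.mem_top _)),
      zero_sub]

/-- Lemma 3.2, first part; purely even case.
Let `L` be a finite-dimensional Lie algebra over a field `𝔽` and `Z` a central ideal
of `L`.  Let `μ` be a linear section of the quotient map `L → L/Z`, with factor set
`f(q,r) = ⁅μ q, μ r⁆ − μ ⁅q,r⁆ ∈ Z`, and let
`Tra : Hom(Z,𝔽) → H²(L/Z,𝔽)`, `Tra α = [α ∘ f]`, be the associated transgression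
(a linear map `T` characterized by: `T α` is the class of a cocycle agreeing with
`α ∘ f`).  Then `⁅L,L⁆ ∩ Z` is isomorphic as an `𝔽`-vector space to the image
of `Tra`. -/
theorem derived_inter_central_iso_range_transgression
    {L : Type*} [LieRing L] [LieAlgebra 𝔽 L] [FiniteDimensional 𝔽 L]
    (Z : LieIdeal 𝔽 L)
    (hcent : ∀ z ∈ Z, ∀ x : L, ⁅z, x⁆ = 0)
    (μ : (L ⧸ Z) →ₗ[𝔽] L)
    (hsec : ∀ q : L ⧸ Z, lieQuotMk Z (μ q) = q)
    (hmem : ∀ q r : L ⧸ Z, ⁅μ q, μ r⁆ - μ ⁅q, r⁆ ∈ Z)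
    (T : (Z →ₗ[𝔽] 𝔽) →ₗ[𝔽] lieH2 𝔽 (L ⧸ Z))
    (hT : ∀ α : Z →ₗ[𝔽] 𝔽, ∃ c : lieZ2 𝔽 (L ⧸ Z),
      (∀ q r : L ⧸ Z, (c : (L ⧸ Z) →ₗ[𝔽] (L ⧸ Z) →ₗ[𝔽] 𝔽) q r =
        α ⟨⁅μ q, μ r⁆ - μ ⁅q, r⁆, hmem q r⟩) ∧
      T α = Submodule.Quotient.mk c) :
    Nonempty
      ((↥(⁅(⊤ : LieIdeal 𝔽 L), (⊤ : LieIdeal 𝔽 L)⁆ ⊓ Z : LieIdeal 𝔽 L)) ≃ₗ[𝔽]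
        ↥(LinearMap.range T)) := by
  let W : LieIdeal 𝔽 L := ⁅(⊤ : LieIdeal 𝔽 L), (⊤ : LieIdeal 𝔽 L)⁆ ⊓ Z
  let ι : W →ₗ[𝔽] Z := Submodule.inclusion (p := W.toSubmodule) (p' := Z.toSubmodule)
    fun _ hx => hx.2
  have hι : Function.Injective ι := Submodule.inclusion_injective _
  have hker : LinearMap.ker T = LinearMap.ker ι.dualMap := by
    ext α
    obtain ⟨c, hc, hTc⟩ := hT α
    rw [LinearMap.mem_ker, LinearMap.mem_ker, hTc, Submodule.Quotient.mk_eq_zero]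
    have hcob : c ∈ lieB2 𝔽 (L ⧸ Z) ↔ ∃ σ : (L ⧸ Z) →ₗ[𝔽] 𝔽, ∀ q r : L ⧸ Z,
        α ⟨⁅μ q, μ r⁆ - μ ⁅q, r⁆, hmem q r⟩ = -σ ⁅q, r⁆ := by
      simp only [← hc]
      rfl
    rw [hcob, factorSet_coboundary_iff Z hcent μ hsec hmem α]
    exact ⟨fun h => LinearMap.ext fun w => h (ι w) w.2.1,
      fun h z hz => LinearMap.congr_fun h ⟨z, hz, z.2⟩⟩
  have hdual : Nonempty (W ≃ₗ[𝔽] Module.Dual 𝔽 W) :=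
    ⟨LinearEquiv.ofFinrankEq _ _ Subspace.dual_finrank_eq.symm⟩
  obtain ⟨e⟩ := hdual
  exact ⟨e ≪≫ₗ (ι.dualMap.quotKerEquivOfSurjective
    (LinearMap.dualMap_surjective_of_injective hι)).symm ≪≫ₗ
    Submodule.quotEquivOfEq _ _ hker.symm ≪≫ₗ T.quotKerEquivRange⟩
end

section
/- Let L be a finite-dimensional Lie algebra over a field 𝔽 and Z a central ideal of L. If the transgression map Tra : Hom(Z, 𝔽) → H²(L/Z, 𝔽) is surjective, then ⁅L,L⁆ ∩ Z ≅ H²(L/Z, 𝔽) as 𝔽-vector spaces. -/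
set_option maxSynthPendingDepth 3

variable (𝔽 A : Type*) [Field 𝔽] [LieRing A] [LieAlgebra 𝔽 A]

/-- A functional on `N` whose kernel contains `D ⊓ N` extends to a functional on the ambient space
vanishing on `D`. -/
theorem Submodule.exists_dual_extend_of_forall_inf {K V : Type*} [Field K] [AddCommGroup V]
    [Module K V] (D N : Submodule K V) (α : N →ₗ[K] K)
    (h : ∀ z : N, (z : V) ∈ D → α z = 0) :
    ∃ φ : V →ₗ[K] K, (∀ x ∈ D, φ x = 0) ∧ ∀ z : N, φ z = α z := by
  have hα : α ∈ LinearMap.range (D.mkQ.comp N.subtype).dualMap := by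
    rw [LinearMap.range_dualMap_eq_dualAnnihilator_ker, Submodule.mem_dualAnnihilator]
    intro z hz
    exact h z (by simpa using hz)
  obtain ⟨β, hβ⟩ := hα
  refine ⟨β.comp D.mkQ, fun x hx => ?_, fun z => ?_⟩
  · simp [(Submodule.Quotient.mk_eq_zero D).2 hx]
  · simp [← hβ]

/-- A functional vanishing on all brackets vanishes on the derived ideal. -/
theorem LieIdeal.apply_eq_zero_of_mem_lie_top {K L : Type*} [Field K] [LieRing L]
    [LieAlgebra K L] (φ : L →ₗ[K] K) (h : ∀ x y : L, φ ⁅x, y⁆ = 0) {x : L}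
    (hx : x ∈ ⁅(⊤ : LieIdeal K L), (⊤ : LieIdeal K L)⁆) : φ x = 0 := by
  rw [← LieSubmodule.mem_toSubmodule, LieSubmodule.lieIdeal_oper_eq_linear_span'] at hx
  refine (Submodule.span_le (p := LinearMap.ker φ)).2 ?_ hx
  rintro _ ⟨a, -, b, -, rfl⟩
  exact h a b

/-- The pullback of a functional `α` along the factor set of a section of a central extension is
a coboundary exactly when `α` vanishes on the part of the centre lying in the derived ideal. -/
theorem exists_factorSet_eq_coboundary_iff {K L : Type*} [Field K] [LieRing L] [LieAlgebra K L]
    (Z : LieIdeal K L) (hcent : ∀ z ∈ Z, ∀ x : L, ⁅z, x⁆ = 0)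
    (μ : (L ⧸ Z) →ₗ[K] L) (hsec : ∀ q : L ⧸ Z, lieQuotMk Z (μ q) = q)
    (hmem : ∀ q r : L ⧸ Z, ⁅μ q, μ r⁆ - μ ⁅q, r⁆ ∈ Z) (α : Z →ₗ[K] K) :
    (∃ σ : (L ⧸ Z) →ₗ[K] K,
      ∀ q r : L ⧸ Z, α ⟨⁅μ q, μ r⁆ - μ ⁅q, r⁆, hmem q r⟩ = -σ ⁅q, r⁆) ↔
    ∀ z : Z, (z : L) ∈ ⁅(⊤ : LieIdeal K L), (⊤ : LieIdeal K L)⁆ → α z = 0 := by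
  have mk_eq_zero : ∀ {x : L}, lieQuotMk Z x = 0 ↔ x ∈ Z := fun {x} =>
    Submodule.Quotient.mk_eq_zero Z.toSubmodule
  have sub_mem (x : L) : x - μ (lieQuotMk Z x) ∈ Z := by
    rw [← mk_eq_zero, map_sub, hsec, sub_self]
  constructor
  · rintro ⟨σ, hσ⟩ z hz
    let π : L →ₗ[K] L ⧸ Z := (lieQuotMk Z : L →ₗ[K] L ⧸ Z)
    let p : L →ₗ[K] Z := (LinearMap.id - μ.comp π).codRestrict Z.toSubmodule sub_mem
    have hφ : ∀ x y : L, (α.comp p + σ.comp π) ⁅x, y⁆ = 0 := by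
      intro x y
      have hπ : π ⁅x, y⁆ = ⁅π x, π y⁆ := (lieQuotMk Z).map_lie x y
      have hbr : ⁅x, y⁆ = ⁅μ (π x), μ (π y)⁆ := by
        have h1 := hcent _ (sub_mem x) y
        have h2 := hcent _ (sub_mem y) (μ (π x))
        rw [sub_lie, sub_eq_zero] at h1
        rw [← lie_skew, neg_eq_zero, lie_sub, sub_eq_zero] at h2
        exact h1.trans h2
      have hp : p ⁅x, y⁆ = ⟨⁅μ (π x), μ (π y)⁆ - μ ⁅π x, π y⁆, hmem _ _⟩ := by
        apply Subtype.ext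
        change ⁅x, y⁆ - μ (π ⁅x, y⁆) = _
        rw [hπ, hbr]
      rw [LinearMap.add_apply, LinearMap.comp_apply, LinearMap.comp_apply, hp, hσ, hπ,
        neg_add_cancel]
    have hπz : π z = 0 := mk_eq_zero.2 z.2
    have hpz : p z = z := by
      apply Subtype.ext
      change (z : L) - μ (π z) = z
      rw [hπz, map_zero, sub_zero]
    have := LieIdeal.apply_eq_zero_of_mem_lie_top _ hφ hz
    rwa [LinearMap.add_apply, LinearMap.comp_apply, LinearMap.comp_apply, hpz, hπz, map_zero,
      add_zero] at this
  · intro h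
    obtain ⟨φ, hD, hZ⟩ := Submodule.exists_dual_extend_of_forall_inf
      (⁅(⊤ : LieIdeal K L), (⊤ : LieIdeal K L)⁆).toSubmodule Z.toSubmodule α h
    refine ⟨φ.comp μ, fun q r => ?_⟩
    have hbr : φ ⁅μ q, μ r⁆ = 0 :=
      hD _ (LieSubmodule.lie_mem_lie (LieSubmodule.mem_top _) (LieSubmodule.mem_top _))
    refine (hZ ⟨_, hmem q r⟩).symm.trans ?_
    simp [hbr]


/-- Lemma 3.2, second part; purely even case.
Let `L` be a finite-dimensional Lie algebra over a field `𝔽` and `Z` a central ideal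
of `L`.  Let `μ` be a linear section of the quotient map `L → L/Z`, with factor set
`f(q,r) = ⁅μ q, μ r⁆ − μ ⁅q,r⁆ ∈ Z`, and let
`Tra : Hom(Z,𝔽) → H²(L/Z,𝔽)`, `Tra α = [α ∘ f]`, be the associated transgression
(a linear map `T` characterized by: `T α` is the class of a cocycle agreeing with
`α ∘ f`).  If `Tra` is surjective, then `⁅L,L⁆ ∩ Z ≅ H²(L/Z,𝔽)` as `𝔽`-vector
spaces. -/
theorem derived_inter_central_iso_H2_of_surjective
    {L : Type*} [LieRing L] [LieAlgebra 𝔽 L] [FiniteDimensional 𝔽 L]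
    (Z : LieIdeal 𝔽 L)
    (hcent : ∀ z ∈ Z, ∀ x : L, ⁅z, x⁆ = 0)
    (μ : (L ⧸ Z) →ₗ[𝔽] L)
    (hsec : ∀ q : L ⧸ Z, lieQuotMk Z (μ q) = q)
    (hmem : ∀ q r : L ⧸ Z, ⁅μ q, μ r⁆ - μ ⁅q, r⁆ ∈ Z)
    (T : (Z →ₗ[𝔽] 𝔽) →ₗ[𝔽] lieH2 𝔽 (L ⧸ Z))
    (hT : ∀ α : Z →ₗ[𝔽] 𝔽, ∃ c : lieZ2 𝔽 (L ⧸ Z),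
      (∀ q r : L ⧸ Z, (c : (L ⧸ Z) →ₗ[𝔽] (L ⧸ Z) →ₗ[𝔽] 𝔽) q r =
        α ⟨⁅μ q, μ r⁆ - μ ⁅q, r⁆, hmem q r⟩) ∧
      T α = Submodule.Quotient.mk c)
    (hTsurj : Function.Surjective T) :
    Nonempty
      ((↥(⁅(⊤ : LieIdeal 𝔽 L), (⊤ : LieIdeal 𝔽 L)⁆ ⊓ Z : LieIdeal 𝔽 L)) ≃ₗ[𝔽]
        lieH2 𝔽 (L ⧸ Z)) := by
  let W : LieIdeal 𝔽 L := ⁅(⊤ : LieIdeal 𝔽 L), (⊤ : LieIdeal 𝔽 L)⁆ ⊓ Z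
  let ι : W →ₗ[𝔽] Z := Submodule.inclusion (p := W.toSubmodule) (p' := Z.toSubmodule)
    fun _ hx => hx.2
  have hι : Function.Injective ι := Submodule.inclusion_injective _
  have hker : LinearMap.ker T = LinearMap.ker ι.dualMap := by
    ext α
    obtain ⟨c, hc, hTc⟩ := hT α
    have hα := exists_factorSet_eq_coboundary_iff Z hcent μ hsec hmem α
    simp only [← hc] at hα
    rw [LinearMap.mem_ker, hTc, Submodule.Quotient.mk_eq_zero, LinearMap.mem_ker]
    refine Iff.trans hα ⟨fun h => ?_, fun h z hz => ?_⟩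
    · ext w
      exact h (ι w) w.2.1
    · exact LinearMap.congr_fun h ⟨z, hz, z.2⟩
  have eW : W ≃ₗ[𝔽] Module.Dual 𝔽 W := (Module.finBasis 𝔽 W).toDualEquiv
  exact ⟨eW ≪≫ₗ
    (LinearMap.quotKerEquivOfSurjective _ (LinearMap.dualMap_surjective_of_injective hι)).symm ≪≫ₗ
    Submodule.quotEquivOfEq _ _ hker.symm ≪≫ₗ LinearMap.quotKerEquivOfSurjective T hTsurj⟩
end

section
/- Let 0 → R → F →π→ L → 0 be a free presentation of a Lie algebra L over a field 𝔽. Consider the central extension 0 → R/⁅F,R⁆ → F/⁅F,R⁆ →π̃→ L → 0, where π̃ is induced by π. Then the transgression map Tra : Hom(R/⁅F,R⁆, 𝔽) → H²(L, 𝔽) associated to this central extension is surjective. -/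
set_option maxSynthPendingDepth 3

variable (𝔽 A : Type*) [Field 𝔽] [LieRing A] [LieAlgebra 𝔽 A]

variable {𝔽 A}

/-- The central extension of `A` by `𝔽` attached to a 2-cocycle `g`: the module `A × 𝔽` with
bracket `⁅(x, s), (y, t)⁆ = (⁅x, y⁆, g x y)`. -/
def LieCentralExtension (_g : lieZ2 𝔽 A) := A × 𝔽

namespace LieCentralExtension

variable (g : lieZ2 𝔽 A)

instance : AddCommGroup (LieCentralExtension g) := inferInstanceAs (AddCommGroup (A × 𝔽))

instance : Module 𝔽 (LieCentralExtension g) := inferInstanceAs (Module 𝔽 (A × 𝔽))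

/-- The projection of the central extension onto its base, as a linear map. -/
def fstₗ : LieCentralExtension g →ₗ[𝔽] A := LinearMap.fst 𝔽 A 𝔽

/-- The projection of the central extension onto its centre coordinate, as a linear map. -/
def sndₗ : LieCentralExtension g →ₗ[𝔽] 𝔽 := LinearMap.snd 𝔽 A 𝔽

variable {g} in
theorem ext_proj {u v : LieCentralExtension g} (h₁ : fstₗ g u = fstₗ g v)
    (h₂ : sndₗ g u = sndₗ g v) : u = v :=
  Prod.ext h₁ h₂

instance : Bracket (LieCentralExtension g) (LieCentralExtension g) where
  bracket u v := (⁅fstₗ g u, fstₗ g v⁆, g.1 (fstₗ g u) (fstₗ g v))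

@[simp]
theorem fstₗ_lie (u v : LieCentralExtension g) : fstₗ g ⁅u, v⁆ = ⁅fstₗ g u, fstₗ g v⁆ := rfl

@[simp]
theorem sndₗ_lie (u v : LieCentralExtension g) :
    sndₗ g ⁅u, v⁆ = g.1 (fstₗ g u) (fstₗ g v) := rfl

theorem cocycle_skew (x y : A) : g.1 x y = -g.1 y x := by
  have h := g.2.1 (x + y)
  simp only [map_add, LinearMap.add_apply, g.2.1 x, g.2.1 y] at h
  linear_combination h

instance : LieRing (LieCentralExtension g) where
  add_lie u v w := ext_proj (by simp) (by simp)
  lie_add u v w := ext_proj (by simp) (by simp)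
  lie_self u := ext_proj (by simp) (by simpa using g.2.1 (fstₗ g u))
  leibniz_lie u v w := ext_proj (by simp) <| by
    have h := g.2.2 (fstₗ g u) (fstₗ g v) (fstₗ g w)
    rw [← lie_skew (fstₗ g w) (fstₗ g u), map_neg, LinearMap.neg_apply,
      cocycle_skew g ⁅fstₗ g v, fstₗ g w⁆, cocycle_skew g ⁅fstₗ g u, fstₗ g w⁆] at h
    simp only [sndₗ_lie, fstₗ_lie, map_add]
    linear_combination -h

instance : LieAlgebra 𝔽 (LieCentralExtension g) where
  lie_smul t u v := ext_proj (by simp) (by simp)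

/-- The projection of the central extension onto its base, as a Lie algebra homomorphism. -/
def proj : LieCentralExtension g →ₗ⁅𝔽⁆ A := { fstₗ g with map_lie' := rfl }

end LieCentralExtension

/-- The pullback of a 2-cocycle to a free Lie algebra is a coboundary. -/
theorem exists_linearMap_lie_eq_cocycle {X : Type*} (π : FreeLieAlgebra 𝔽 X →ₗ⁅𝔽⁆ A)
    (g : lieZ2 𝔽 A) :
    ∃ l : FreeLieAlgebra 𝔽 X →ₗ[𝔽] 𝔽, ∀ a b, l ⁅a, b⁆ = g.1 (π a) (π b) := by
  let φ : FreeLieAlgebra 𝔽 X →ₗ⁅𝔽⁆ LieCentralExtension g :=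
    FreeLieAlgebra.lift 𝔽 fun x =>
      (show LieCentralExtension g from (π (FreeLieAlgebra.of 𝔽 x), (0 : 𝔽)))
  have hφ : (LieCentralExtension.proj g).comp φ = π := by
    ext x
    exact congrArg (LieCentralExtension.proj g) (FreeLieAlgebra.lift_of_apply _ x)
  have hfst (a) : LieCentralExtension.fstₗ g (φ a) = π a := LieHom.congr_fun hφ a
  refine ⟨LieCentralExtension.sndₗ g ∘ₗ (φ : FreeLieAlgebra 𝔽 X →ₗ[𝔽] _), fun a b => ?_⟩
  simp [hfst]

/-- A linear functional on `B` whose values on brackets factor through `π` vanishes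
on `⁅B, ker π⁆`. -/
theorem lie_top_ker_le_ker {B : Type*} [LieRing B] [LieAlgebra 𝔽 B] (π : B →ₗ⁅𝔽⁆ A)
    (g : A →ₗ[𝔽] A →ₗ[𝔽] 𝔽) (l : B →ₗ[𝔽] 𝔽) (hl : ∀ a b, l ⁅a, b⁆ = g (π a) (π b)) :
    (⁅(⊤ : LieIdeal 𝔽 B), π.ker⁆ : LieIdeal 𝔽 B).toSubmodule ≤ LinearMap.ker l := by
  rw [LieSubmodule.lieIdeal_oper_eq_linear_span', Submodule.span_le]
  rintro _ ⟨a, -, b, hb, rfl⟩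
  have hb : π b = 0 := LieHom.mem_ker.mp hb
  simp [hl, hb]

variable (𝔽 A)

/-- Lemma 3.3; purely even case.
Let `0 → R → F →π→ L → 0` be a free presentation of a Lie algebra `L` over a field
`𝔽` (`F` a free Lie algebra, `R = ker π`).  Consider the central extension
`0 → R/⁅F,R⁆ → F/⁅F,R⁆ →π̃→ L → 0`, where `π̃ = p` is induced by `π`, with a linear
section `μ` of `p` and factor set `f(x,y) = ⁅μ x, μ y⁆ − μ ⁅x,y⁆ ∈ R/⁅F,R⁆`.  Then
the transgression map `Tra : Hom(R/⁅F,R⁆, 𝔽) → H²(L,𝔽)`, `Tra α = [α ∘ f]`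
(a linear map `T` characterized by: `T α` is the class of a cocycle agreeing with
`α ∘ f`), is surjective. -/
theorem transgression_surjective_of_free_presentation
    {X L : Type*} [LieRing L] [LieAlgebra 𝔽 L]
    (π : FreeLieAlgebra 𝔽 X →ₗ⁅𝔽⁆ L) (hπ : Function.Surjective π)
    (p : (FreeLieAlgebra 𝔽 X ⧸
        ⁅(⊤ : LieIdeal 𝔽 (FreeLieAlgebra 𝔽 X)), π.ker⁆) →ₗ⁅𝔽⁆ L)
    (hp : ∀ x : FreeLieAlgebra 𝔽 X,
      p (lieQuotMk ⁅(⊤ : LieIdeal 𝔽 (FreeLieAlgebra 𝔽 X)), π.ker⁆ x) = π x)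
    (μ : L →ₗ[𝔽] (FreeLieAlgebra 𝔽 X ⧸
        ⁅(⊤ : LieIdeal 𝔽 (FreeLieAlgebra 𝔽 X)), π.ker⁆))
    (hsec : ∀ x : L, p (μ x) = x)
    (hmem : ∀ x y : L, ⁅μ x, μ y⁆ - μ ⁅x, y⁆ ∈
      LieIdeal.map (lieQuotMk ⁅(⊤ : LieIdeal 𝔽 (FreeLieAlgebra 𝔽 X)), π.ker⁆) π.ker)
    (T : ((LieIdeal.map
        (lieQuotMk ⁅(⊤ : LieIdeal 𝔽 (FreeLieAlgebra 𝔽 X)), π.ker⁆) π.ker) →ₗ[𝔽] 𝔽)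
      →ₗ[𝔽] lieH2 𝔽 L)
    (hT : ∀ α, ∃ c : lieZ2 𝔽 L,
      (∀ x y : L, (c : L →ₗ[𝔽] L →ₗ[𝔽] 𝔽) x y =
        α ⟨⁅μ x, μ y⁆ - μ ⁅x, y⁆, hmem x y⟩) ∧
      T α = Submodule.Quotient.mk c) :
    Function.Surjective T := by
  intro q
  obtain ⟨g, rfl⟩ := Submodule.Quotient.mk_surjective _ q
  obtain ⟨l, hl⟩ := exists_linearMap_lie_eq_cocycle π g
  let lbar := Submodule.liftQ _ l (lie_top_ker_le_ker π g.1 l hl)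
  have hlbar : ∀ u v, lbar ⁅u, v⁆ = g.1 (p u) (p v) := by
    intro u v
    obtain ⟨a, rfl⟩ := Submodule.Quotient.mk_surjective _ u
    obtain ⟨b, rfl⟩ := Submodule.Quotient.mk_surjective _ v
    exact (hl a b).trans (congrArg₂ (fun s t => g.1 s t) (hp a).symm (hp b).symm)
  let α := lbar.domRestrict (LieIdeal.map
    (lieQuotMk ⁅(⊤ : LieIdeal 𝔽 (FreeLieAlgebra 𝔽 X)), π.ker⁆) π.ker).toSubmodule
  obtain ⟨c, hc, hTc⟩ := hT α
  refine ⟨α, hTc.trans ((Submodule.Quotient.eq _).mpr ⟨lbar ∘ₗ μ, fun x y => ?_⟩)⟩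
  have hα : α ⟨⁅μ x, μ y⁆ - μ ⁅x, y⁆, hmem x y⟩ = g.1 x y - lbar (μ ⁅x, y⁆) := by
    change lbar (⁅μ x, μ y⁆ - μ ⁅x, y⁆) = _
    rw [map_sub, hlbar, hsec, hsec]
  rw [Submodule.coe_sub, LinearMap.sub_apply, LinearMap.sub_apply, hc, hα, LinearMap.comp_apply]
  ring
end
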